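/- Fix ε > 0, δ ∈ (0, 1/2], Δ > 0, and a positive integer m. Set σ = Δ/ε and s = (Δ/ε)·log(m(e^ε − 1)/δ + 1). Let z be a random vector in ℝ^m whose coordinates are independent, each distributed with the truncated Laplace density with scale σ and support [−s, s]. Then for any two vectors v, v′ ∈ ℝ^m with ‖v − v′‖₁ ≤ Δ and every Borel set T ⊆ ℝ^m, one has P[v + z ∈ T] ≤ e^ε · P[v′ + z ∈ T] + δ. (Multivariate Truncated Laplace Mechanism is (ε, δ)-differentially private.) -/

import Mathlib

open MeasureTheory

/-- The truncated Laplace density with scale `σ` and support `[-s, s]`. -/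
noncomputable def truncLapPdf (σ s z : ℝ) : ℝ :=
  if |z| ≤ s then Real.exp (-|z| / σ) / (2 * σ * (1 - Real.exp (-s / σ))) else 0

/-- The law of a real random variable with the truncated Laplace density. -/
noncomputable def truncLap (σ s : ℝ) : Measure ℝ :=
  volume.withDensity fun z => ENNReal.ofReal (truncLapPdf σ s z)

theorem MeasureTheory.Measure.pi_mono {ι : Type*} [Fintype ι] {α : ι → Type*}
    [∀ i, MeasurableSpace (α i)] {μ ν : ∀ i, Measure (α i)} (h : ∀ i, μ i ≤ ν i) :
    Measure.pi μ ≤ Measure.pi ν := by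
  refine Measure.le_iff.2 fun s hs => ?_
  rw [Measure.pi, Measure.pi, toMeasure_apply _ _ hs, toMeasure_apply _ _ hs]
  refine OuterMeasure.le_pi.2 (fun t _ => ?_) s
  exact (OuterMeasure.pi_pi_le _ _).trans (Finset.prod_le_prod' fun i _ => h i (t i))

theorem MeasureTheory.Measure.pi_nnreal_smul {ι : Type*} [Fintype ι] {α : ι → Type*}
    [∀ i, MeasurableSpace (α i)] (c : ι → NNReal) (μ : ∀ i, Measure (α i))
    [∀ i, IsFiniteMeasure (μ i)] :
    Measure.pi (fun i => c i • μ i) = (∏ i, c i) • Measure.pi μ := by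
  refine Measure.pi_eq fun s _ => ?_
  simp only [Measure.smul_apply, Measure.pi_pi, ENNReal.smul_def, smul_eq_mul,
    Finset.prod_mul_distrib, ENNReal.ofNNReal_finsetProd]

theorem lintegral_Icc_exp_mul_div {k ζ a b : ℝ} (hk : k ≠ 0) (hζ : 0 < ζ) (hab : a ≤ b) :
    ∫⁻ z in Set.Icc a b, ENNReal.ofReal (Real.exp (k * z) / ζ) =
      ENNReal.ofReal ((Real.exp (k * b) - Real.exp (k * a)) / (k * ζ)) := by
  have hc : Continuous fun z : ℝ => Real.exp (k * z) / ζ := by fun_prop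
  rw [← ofReal_integral_eq_lintegral_ofReal hc.continuousOn.integrableOn_Icc
    (Filter.Eventually.of_forall fun z => by positivity), integral_Icc_eq_integral_Ioc,
    ← intervalIntegral.integral_of_le hab]
  congr 1
  rw [intervalIntegral.integral_eq_sub_of_hasDerivAt
    (f := fun z => Real.exp (k * z) / (k * ζ)) ?_ (hc.intervalIntegrable _ _)]
  · ring
  · intro x _
    have h := (((hasDerivAt_id x).const_mul k).exp).div_const (k * ζ)
    refine h.congr_deriv ?_
    simp only [id]
    field_simp

section TruncLap

variable {σ s : ℝ}

theorem truncLap_normalizer_pos (hσ : 0 < σ) (hs : 0 < s) :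
    0 < 2 * σ * (1 - Real.exp (-s / σ)) := by
  have : Real.exp (-s / σ) < 1 :=
    Real.exp_lt_one_iff.2 (div_neg_of_neg_of_pos (by linarith) hσ)
  have : 0 < 1 - Real.exp (-s / σ) := by linarith
  positivity

theorem measurable_truncLapPdf : Measurable (truncLapPdf σ s) := by
  unfold truncLapPdf
  refine Measurable.ite (measurableSet_le (by fun_prop) (by fun_prop)) (by fun_prop) (by fun_prop)

theorem truncLap_apply_eq_setLIntegral {A : Set ℝ} (hA : MeasurableSet A) :
    truncLap σ s A = ∫⁻ z in A, ENNReal.ofReal (truncLapPdf σ s z) :=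
  withDensity_apply _ hA

theorem truncLap_compl_Icc : truncLap σ s (Set.Icc (-s) s)ᶜ = 0 := by
  rw [truncLap_apply_eq_setLIntegral measurableSet_Icc.compl]
  refine setLIntegral_eq_zero measurableSet_Icc.compl fun z hz => ?_
  have : ¬ |z| ≤ s := fun h => hz (abs_le.1 h)
  simp [truncLapPdf, this]

theorem truncLap_Icc_le {k a b : ℝ} (hσ : 0 < σ) (hs : 0 < s) (hk : |k| = 1 / σ) (hab : a ≤ b) :
    truncLap σ s (Set.Icc a b) ≤ ENNReal.ofReal
      ((Real.exp (k * b) - Real.exp (k * a)) / (k * (2 * σ * (1 - Real.exp (-s / σ))))) := by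
  have hζ := truncLap_normalizer_pos hσ hs
  have hk0 : k ≠ 0 := by
    rintro rfl
    rw [abs_zero] at hk
    exact (one_div_pos.2 hσ).ne hk
  rw [truncLap_apply_eq_setLIntegral measurableSet_Icc, ← lintegral_Icc_exp_mul_div hk0 hζ hab]
  refine lintegral_mono fun z => ENNReal.ofReal_le_ofReal ?_
  unfold truncLapPdf
  split_ifs
  · gcongr
    have h := neg_abs_le (k * z)
    rw [abs_mul, hk] at h
    calc -|z| / σ = -(1 / σ * |z|) := by ring
      _ ≤ k * z := h
  · positivity

theorem isProbabilityMeasure_truncLap (hσ : 0 < σ) (hs : 0 < s) :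
    IsProbabilityMeasure (truncLap σ s) := by
  have hζ := truncLap_normalizer_pos hσ hs
  have hE : 1 - Real.exp (-s / σ) ≠ 0 := fun h => by simp [h] at hζ
  have hhalf : (1 - Real.exp (-s / σ)) / (1 / σ * (2 * σ * (1 - Real.exp (-s / σ)))) = 1 / 2 := by
    generalize Real.exp (-s / σ) = e at hE
    field_simp
  have hpos : truncLap σ s (Set.Icc 0 s) = ENNReal.ofReal (1 / 2) := by
    rw [truncLap_apply_eq_setLIntegral measurableSet_Icc]
    calc _ = ∫⁻ z in Set.Icc 0 s, ENNReal.ofReal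
          (Real.exp (-(1 / σ) * z) / (2 * σ * (1 - Real.exp (-s / σ)))) := by
          refine setLIntegral_congr_fun measurableSet_Icc fun z hz => ?_
          have h : |z| ≤ s := by rw [abs_of_nonneg hz.1]; exact hz.2
          rw [truncLapPdf, if_pos h, abs_of_nonneg hz.1]
          congr 3
          ring
      _ = _ := by
          rw [lintegral_Icc_exp_mul_div (by simp [hσ.ne']) hζ hs.le]
          congr 1
          rw [show -(1 / σ) * s = -s / σ by ring, mul_zero, Real.exp_zero,
            ← hhalf, neg_mul, div_neg, ← neg_div, neg_sub]
  have hneg : truncLap σ s (Set.Icc (-s) 0) = ENNReal.ofReal (1 / 2) := by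
    rw [truncLap_apply_eq_setLIntegral measurableSet_Icc]
    calc _ = ∫⁻ z in Set.Icc (-s) 0, ENNReal.ofReal
          (Real.exp (1 / σ * z) / (2 * σ * (1 - Real.exp (-s / σ)))) := by
          refine setLIntegral_congr_fun measurableSet_Icc fun z hz => ?_
          have h : |z| ≤ s := by rw [abs_of_nonpos hz.2]; linarith [hz.1]
          rw [truncLapPdf, if_pos h, abs_of_nonpos hz.2]
          congr 3
          ring
      _ = _ := by
          rw [lintegral_Icc_exp_mul_div (by simp [hσ.ne']) hζ (by linarith)]
          congr 1
          rw [show 1 / σ * -s = -s / σ by ring, mul_zero, Real.exp_zero, hhalf]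
  have hzero : truncLap σ s {0} = 0 :=
    withDensity_absolutelyContinuous _ _ Real.volume_singleton
  have hd : AEDisjoint (truncLap σ s) (Set.Icc (-s) 0) (Set.Icc 0 s) := by
    refine measure_mono_null (fun z hz => ?_) hzero
    exact le_antisymm hz.1.2 hz.2.1
  refine ⟨?_⟩
  rw [← measure_add_measure_compl (measurableSet_Icc (a := -s) (b := s)), truncLap_compl_Icc,
    add_zero, ← Set.Icc_union_Icc_eq_Icc (by linarith : -s ≤ 0) hs.le,
    measure_union₀ measurableSet_Icc.nullMeasurableSet hd, hpos, hneg,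
    ← ENNReal.ofReal_add (by norm_num) (by norm_num)]
  norm_num

theorem truncLapPdf_le_exp_mul_shift (hσ : 0 < σ) (hs : 0 < s) {x d : ℝ} (h : |x + d| ≤ s) :
    truncLapPdf σ s x ≤ Real.exp (|d| / σ) * truncLapPdf σ s (x + d) := by
  have hζ := truncLap_normalizer_pos hσ hs
  unfold truncLapPdf
  rw [if_pos h]
  split_ifs
  · rw [← mul_div_assoc, ← Real.exp_add, ← add_div]
    gcongr
    linarith [abs_add_le x d]
  · positivity

theorem restrict_map_truncLap_le (hσ : 0 < σ) (hs : 0 < s) (d : ℝ) :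
    ((truncLap σ s).map (· + d)).restrict (Set.Icc (-s) s) ≤
      (Real.exp (|d| / σ)).toNNReal • truncLap σ s := by
  refine Measure.le_iff.2 fun A hA => ?_
  have hAB : MeasurableSet (A ∩ Set.Icc (-s) s) := hA.inter measurableSet_Icc
  have hm : Measurable fun x : ℝ => x + d := measurable_add_const d
  have hf := (measurable_truncLapPdf (σ := σ) (s := s)).ennreal_ofReal
  rw [Measure.restrict_apply hA, Measure.map_apply hm hAB,
    truncLap_apply_eq_setLIntegral (hm hAB), Measure.smul_apply, ENNReal.smul_def, smul_eq_mul]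
  calc _ ≤ ∫⁻ x in (· + d) ⁻¹' (A ∩ Set.Icc (-s) s),
        ENNReal.ofReal (Real.exp (|d| / σ)) * ENNReal.ofReal (truncLapPdf σ s (x + d)) := by
        refine setLIntegral_mono' (hm hAB) fun x hx => ?_
        rw [← ENNReal.ofReal_mul (Real.exp_nonneg _)]
        exact ENNReal.ofReal_le_ofReal (truncLapPdf_le_exp_mul_shift hσ hs (abs_le.2 hx.2))
    _ = ENNReal.ofReal (Real.exp (|d| / σ)) * truncLap σ s (A ∩ Set.Icc (-s) s) := by
        rw [truncLap_apply_eq_setLIntegral hAB, lintegral_const_mul _ (by exact hf.comp hm),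
          (measurePreserving_add_right volume d).setLIntegral_comp_preimage hAB hf]
    _ ≤ _ := mul_le_mul_right (measure_mono Set.inter_subset_left) _

theorem map_truncLap_compl_Icc_le (hσ : 0 < σ) (hs : 0 < s) (d : ℝ) :
    (truncLap σ s).map (· + d) (Set.Icc (-s) s)ᶜ ≤ ENNReal.ofReal
      ((Real.exp (|d| / σ) - 1) / (2 * (Real.exp (s / σ) - 1))) := by
  have hE : Real.exp (s / σ) - 1 ≠ 0 := by
    have := Real.add_one_lt_exp (div_pos hs hσ).ne'
    have := div_pos hs hσ
    linarith
  rw [Measure.map_apply (measurable_add_const d) measurableSet_Icc.compl]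
  suffices h : ∃ k a b : ℝ, |k| = 1 / σ ∧ a ≤ b ∧
      (· + d) ⁻¹' (Set.Icc (-s) s)ᶜ ⊆ Set.Icc a b ∪ (Set.Icc (-s) s)ᶜ ∧
      (Real.exp (k * b) - Real.exp (k * a)) / (k * (2 * σ * (1 - Real.exp (-s / σ)))) =
        (Real.exp (|d| / σ) - 1) / (2 * (Real.exp (s / σ) - 1)) by
    obtain ⟨k, a, b, hk, hab, hsub, heq⟩ := h
    refine (measure_mono hsub).trans ((measure_union_le _ _).trans ?_)
    rw [truncLap_compl_Icc, add_zero, ← heq]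
    exact truncLap_Icc_le hσ hs hk hab
  have hσ' : |1 / σ| = 1 / σ := abs_of_pos (one_div_pos.2 hσ)
  have hneg : Real.exp (-s / σ) = (Real.exp (s / σ))⁻¹ := by rw [neg_div, Real.exp_neg]
  have hshift : Real.exp ((|d| - s) / σ) = Real.exp (|d| / σ) * (Real.exp (s / σ))⁻¹ := by
    rw [sub_div, Real.exp_sub, div_eq_mul_inv]
  have hE' : 1 - (Real.exp (s / σ))⁻¹ = (Real.exp (s / σ) - 1) / Real.exp (s / σ) := by
    field_simp
  rcases le_total 0 d with hd | hd
  · refine ⟨-(1 / σ), s - d, s, by rw [abs_neg, hσ'], by linarith, fun x hx => ?_, ?_⟩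
    · by_cases hx' : x ∈ Set.Icc (-s) s
      · refine Or.inl ⟨?_, hx'.2⟩
        by_contra! hlt
        exact hx ⟨by linarith [hx'.1], by linarith⟩
      · exact Or.inr hx'
    · rw [show -(1 / σ) * s = -s / σ by ring,
        show -(1 / σ) * (s - d) = (|d| - s) / σ by rw [abs_of_nonneg hd]; ring, hneg, hshift, hE']
      field_simp
      ring
  · refine ⟨1 / σ, -s, -s - d, hσ', by linarith, fun x hx => ?_, ?_⟩
    · by_cases hx' : x ∈ Set.Icc (-s) s
      · refine Or.inl ⟨hx'.1, ?_⟩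
        by_contra! hlt
        exact hx ⟨by linarith, by linarith [hx'.2]⟩
      · exact Or.inr hx'
    · rw [show 1 / σ * -s = -s / σ by ring,
        show 1 / σ * (-s - d) = (|d| - s) / σ by rw [abs_of_nonpos hd]; ring, hneg, hshift, hE']
      field_simp

theorem pi_truncLap_preimage_add_le {ι : Type*} [Fintype ι] (hσ : 0 < σ) (hs : 0 < s)
    (d : ι → ℝ) {T : Set (ι → ℝ)} (hT : MeasurableSet T) :
    Measure.pi (fun _ => truncLap σ s) ((· + d) ⁻¹' T) ≤
      ENNReal.ofReal (Real.exp ((∑ i, |d i|) / σ)) * Measure.pi (fun _ => truncLap σ s) T +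
      ∑ i, ENNReal.ofReal ((Real.exp (|d i| / σ) - 1) / (2 * (Real.exp (s / σ) - 1))) := by
  have := isProbabilityMeasure_truncLap hσ hs
  have hm (i : ι) : Measurable fun x : ℝ => x + d i := measurable_add_const _
  have (i : ι) : IsProbabilityMeasure ((truncLap σ s).map (· + d i)) :=
    Measure.isProbabilityMeasure_map (hm i).aemeasurable
  set B : Set ℝ := Set.Icc (-s) s
  set M : Measure (ι → ℝ) := Measure.pi fun i => (truncLap σ s).map (· + d i) with hM
  have hmap : (Measure.pi fun _ => truncLap σ s).map (· + d) = M :=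
    Measure.pi_map_pi fun i => (hm i).aemeasurable
  have hbox : MeasurableSet (Set.univ.pi fun _ : ι => B) :=
    MeasurableSet.univ_pi fun _ => measurableSet_Icc
  rw [← Measure.map_apply (measurable_add_const d) hT, hmap,
    ← measure_inter_add_sdiff T hbox, ← Measure.restrict_apply hT]
  refine add_le_add ?_ ?_
  · rw [hM, Measure.restrict_pi_pi]
    refine (Measure.pi_mono (fun i => restrict_map_truncLap_le hσ hs (d i)) T).trans_eq ?_
    rw [Measure.pi_nnreal_smul, Measure.smul_apply, ENNReal.smul_def, smul_eq_mul,
      Finset.sum_div, Real.exp_sum, ← Real.toNNReal_prod_of_nonneg fun i _ => Real.exp_nonneg _]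
    rfl
  · calc M (T \ Set.univ.pi fun _ => B) ≤ M (⋃ i, Function.eval i ⁻¹' Bᶜ) := by
          refine measure_mono fun x hx => ?_
          simpa [Set.mem_pi] using hx.2
      _ ≤ ∑ i, M (Function.eval i ⁻¹' Bᶜ) := measure_iUnion_fintype_le _ _
      _ ≤ _ := Finset.sum_le_sum fun i _ => by
          rw [hM, (measurePreserving_eval _ i).measure_preimage
            measurableSet_Icc.compl.nullMeasurableSet]
          exact map_truncLap_compl_Icc_le hσ hs (d i)

end TruncLap

/-- The Multivariate Truncated Laplace Mechanism is `(ε, δ)`-differentially private. -/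
theorem multivariate_truncated_laplace_dp
    (ε δ Δ : ℝ) (hε : 0 < ε) (hδ0 : 0 < δ) (hδ : δ ≤ 1 / 2) (hΔ : 0 < Δ)
    (m : ℕ) (hm : 0 < m)
    (σ s : ℝ) (hσ : σ = Δ / ε)
    (hs : s = Δ / ε * Real.log ((m : ℝ) * (Real.exp ε - 1) / δ + 1))
    (μz : Measure (Fin m → ℝ))
    (hμz : μz = Measure.pi fun _ : Fin m => truncLap σ s)
    (v v' : Fin m → ℝ)
    (hsens : ∑ i, |v i - v' i| ≤ Δ)
    (T : Set (Fin m → ℝ)) (hT : MeasurableSet T) :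
    μz {z | v + z ∈ T} ≤ ENNReal.ofReal (Real.exp ε) * μz {z | v' + z ∈ T}
      + ENNReal.ofReal δ := by
  have hσ0 : 0 < σ := hσ ▸ div_pos hΔ hε
  have hm0 : (0 : ℝ) < m := Nat.cast_pos.2 hm
  have hexp : 0 < Real.exp ε - 1 := by linarith [Real.add_one_lt_exp hε.ne']
  have hq : 0 < (m : ℝ) * (Real.exp ε - 1) / δ := by positivity
  have hs0 : 0 < s := by
    rw [hs, ← hσ]
    exact mul_pos hσ0 (Real.log_pos (by linarith))
  have hEs : Real.exp (s / σ) - 1 = m * (Real.exp ε - 1) / δ := by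
    rw [hs, ← hσ, mul_div_cancel_left₀ _ hσ0.ne', Real.exp_log (by linarith)]
    ring
  have hΔσ : Δ / σ = ε := by rw [hσ]; field_simp
  have hT' : MeasurableSet {z | v' + z ∈ T} := measurable_const_add v' hT
  have hset : {z | v + z ∈ T} = (· + (v - v')) ⁻¹' {z | v' + z ∈ T} := by
    ext z
    simp only [Set.mem_ofPred_eq, Set.mem_preimage]
    rw [show v' + (z + (v - v')) = v + z by abel]
  rw [hset, hμz]
  refine (pi_truncLap_preimage_add_le hσ0 hs0 (v - v') hT').trans ?_
  simp only [Pi.sub_apply]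
  refine add_le_add ?_ ?_
  · gcongr
    rw [← hΔσ]
    gcongr
  · calc _ ≤ ∑ _i : Fin m, ENNReal.ofReal (δ / m) := by
          refine Finset.sum_le_sum fun i _ => ENNReal.ofReal_le_ofReal ?_
          have hi : |v i - v' i| ≤ Δ := (Finset.single_le_sum
            (f := fun i => |v i - v' i|) (fun _ _ => abs_nonneg _) (Finset.mem_univ i)).trans hsens
          have hi' : Real.exp (|v i - v' i| / σ) ≤ Real.exp ε := by
            rw [← hΔσ]
            gcongr
          rw [hEs]
          calc _ ≤ (Real.exp ε - 1) / (2 * (m * (Real.exp ε - 1) / δ)) := by gcongr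
            _ = δ / m / 2 := by field_simp
            _ ≤ δ / m := half_le_self (by positivity)
      _ = ENNReal.ofReal δ := by
          rw [← ENNReal.ofReal_sum_of_nonneg fun _ _ => by positivity]
          simp [mul_div_cancel₀, hm0.ne']
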